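/- Let x ∈ (0,1) be irrational with regular continued fraction convergent denominators (Q_k)_{k≥0}, and let t ∈ ℝ. If Σ_{k=0}^{∞} log(Q_{k+1}) / √(Q_k) < ∞, then the series F_1(x,t) = Σ_{k=1}^{∞} e^{iπk²x + 2πikt}/k converges (i.e., its partial sums F_{1,n}(x,t) converge as n → ∞). -/

import Mathlib

open Complex Filter Finset

noncomputable section

/-- `ρ = e^{iπ/4}`. -/
def ρ : ℂ := Complex.exp (Real.pi * Complex.I / 4)

/-- Partial sum `F_{s,n}(x,t) = Σ_{k=1}^{n} e^{iπk²x + 2πikt}/k^s`. -/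
def Fpart (s : ℝ) (n : ℕ) (x t : ℝ) : ℂ :=
  ∑ k ∈ Finset.Icc 1 n,
    Complex.exp (Real.pi * Complex.I * (k : ℂ) ^ 2 * (x : ℂ)
        + 2 * Real.pi * Complex.I * (k : ℂ) * (t : ℂ)) / (k : ℂ) ^ (s : ℂ)

/-- The function `I_s(x,t)` (for `x > 0`). -/
def Ifun (s x t : ℝ) : ℂ :=
  (∫ u : ℝ, ρ *
      (Complex.exp (Real.pi * Complex.I * ((1 : ℂ) / 2 + ρ * (u : ℂ)) ^ 2 * (x : ℂ)
            + 2 * Real.pi * Complex.I * ((1 : ℂ) / 2 + ρ * (u : ℂ)) * (Int.fract t : ℝ)) /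
        (((1 : ℂ) / 2 + ρ * (u : ℂ)) ^ (s : ℂ) *
          (1 - Complex.exp (2 * Real.pi * Complex.I * ((1 : ℂ) / 2 + ρ * (u : ℂ)))))))
  + ρ * (x : ℂ) ^ (s : ℂ) *
    ∫ u : ℝ, (Real.exp (-(Real.pi * x * u ^ 2)) : ℝ) *
      ∑' k : ℕ, Complex.exp (-(Real.pi * Complex.I * (((k : ℂ) + 1) - (Int.fract t : ℝ)) ^ 2 / (x : ℂ))) *
        (((ρ * (x : ℂ) * (u : ℂ) + ((k : ℂ) + 1) - (Int.fract t : ℝ)) ^ (s : ℂ))⁻¹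
          - (((k : ℂ) + 1) ^ (s : ℂ))⁻¹)

/-- `Ω_s(x,t)`. -/
def Omega (s x t : ℝ) : ℂ :=
  if 0 < x then Ifun s x t else (starRingEnd ℂ) (Ifun s (-x) (-t))

/-- `Ω_s(x) = Ω_s(x,0)`. -/
def Omega0 (s x : ℝ) : ℂ := Omega s x 0

/-- The map `T(x) = -1/x mod 2`, valued in `(-1,1]`. -/
def Tmap (x : ℝ) : ℝ := -1 / x - 2 * ⌈((-1 / x) - 1) / 2⌉

/-- Denominator `Q_n` of the `n`-th convergent of the regular continued fraction of `x`. -/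
def Qden (x : ℝ) (n : ℕ) : ℝ := (GenContFract.of x).dens n

end

open scoped Topology

theorem GenContFract.exists_int_contsAux_of (x : ℝ) (n : ℕ) :
    ∃ a b : ℤ, (GenContFract.of x).contsAux n = ⟨(a : ℝ), (b : ℝ)⟩ := by
  induction n using Nat.strong_induction_on with
  | _ n ih =>
    match n, ih with
    | 0, _ => exact ⟨1, 0, by simp [GenContFract.contsAux]⟩
    | 1, _ => exact ⟨⌊x⌋, 1, by simp [GenContFract.contsAux, GenContFract.of_h_eq_floor]⟩
    | n + 2, ih =>
      obtain ⟨a₀, b₀, h₀⟩ := ih n (by omega)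
      obtain ⟨a₁, b₁, h₁⟩ := ih (n + 1) (by omega)
      cases hs : (GenContFract.of x).s.get? n with
      | none =>
        exact ⟨a₁, b₁, by
          rw [GenContFract.contsAux_stable_step_of_terminated hs, h₁]⟩
      | some gp =>
        obtain ⟨ha, z, hz⟩ := GenContFract.of_partNum_eq_one_and_exists_int_partDen_eq hs
        refine ⟨z * a₁ + a₀, z * b₁ + b₀, ?_⟩
        rw [GenContFract.contsAux_recurrence hs h₀ h₁, ha, hz]
        push_cast
        simp

theorem exists_convergents_of_irrational {x : ℝ} (hirr : Irrational x) :
    ∃ (P : ℕ → ℤ) (q : ℕ → ℕ), (∀ n, (GenContFract.of x).dens n = q n) ∧ q 0 = 1 ∧ Monotone q ∧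
      (∀ n, Nat.fib (n + 1) ≤ q n) ∧ (∀ n, IsCoprime (P n) (q n)) ∧
      ∀ n, |x - P n / q n| ≤ 1 / (q n * q (n + 1)) := by
  have hterm : ∀ n, ¬ (GenContFract.of x).TerminatedAt n := fun n hn => by
    obtain ⟨r, hr⟩ := (GenContFract.terminates_iff_rat x).1 ⟨n, hn⟩
    exact hirr ⟨r, hr.symm⟩
  choose P b hPb using fun n => GenContFract.exists_int_contsAux_of x (n + 1)
  have hnum : ∀ n, (GenContFract.of x).nums n = P n := fun n => by
    rw [GenContFract.num_eq_conts_a, GenContFract.nth_cont_eq_succ_nth_contAux, hPb]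
  have hden : ∀ n, (GenContFract.of x).dens n = b n := fun n => by
    rw [GenContFract.den_eq_conts_b, GenContFract.nth_cont_eq_succ_nth_contAux, hPb]
  have hb0 : ∀ n, 0 ≤ b n := fun n => by
    have := GenContFract.zero_le_of_den (v := x) (n := n)
    rw [hden] at this
    exact_mod_cast this
  have hbq : ∀ n, (((b n).toNat : ℕ) : ℤ) = b n := fun n => Int.toNat_of_nonneg (hb0 n)
  have hbqR : ∀ n, (((b n).toNat : ℕ) : ℝ) = b n := fun n => by
    exact_mod_cast congrArg (Int.cast : ℤ → ℝ) (hbq n)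
  refine ⟨P, fun n => (b n).toNat, fun n => ?_, ?_, ?_, fun n => ?_, fun n => ?_, fun n => ?_⟩
  · rw [hbqR, hden]
  · have h := hden 0
    rw [GenContFract.zeroth_den_eq_one] at h
    have : b 0 = 1 := by exact_mod_cast h.symm
    simp [this]
  · refine monotone_nat_of_le_succ fun n => Int.toNat_le_toNat ?_
    have := GenContFract.of_den_mono (v := x) (n := n)
    rw [hden, hden] at this
    exact_mod_cast this
  · have := GenContFract.succ_nth_fib_le_of_nth_den (v := x) (n := n) (Or.inr (hterm _))
    rw [hden, ← hbqR] at this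
    exact_mod_cast this
  · have hdet := SimpContFract.determinant (s := SimpContFract.of x) (n := n) (hterm n)
    change (GenContFract.of x).nums n * (GenContFract.of x).dens (n + 1) -
      (GenContFract.of x).dens n * (GenContFract.of x).nums (n + 1) = _ at hdet
    rw [hnum, hnum, hden, hden] at hdet
    have hdet' : P n * b (n + 1) - b n * P (n + 1) = (-1) ^ (n + 1) := by exact_mod_cast hdet
    have hsq : ((-1 : ℤ) ^ (n + 1)) * (-1) ^ (n + 1) = 1 := by
      rw [← mul_pow]; simp
    simp only [hbq]
    exact ⟨b (n + 1) * (-1) ^ (n + 1), -P (n + 1) * (-1) ^ (n + 1), by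
      linear_combination (-1) ^ (n + 1) * hdet' + hsq⟩
  · have := GenContFract.abs_sub_convs_le (v := x) (hterm n)
    rw [GenContFract.conv_eq_num_div_den, hnum, hden, hden] at this
    simpa only [hbqR] using this

theorem sum_mul_conj_succ (a : ℕ → ℂ) (N : ℕ) :
    ∑ h ∈ range (N + 1), ∑ k ∈ range (N - h), a (k + h + 1) * (starRingEnd ℂ) (a k) =
      ∑ h ∈ range N, ∑ k ∈ range (N - 1 - h), a (k + h + 1) * (starRingEnd ℂ) (a k) +
        a N * (starRingEnd ℂ) (∑ k ∈ range N, a k) := by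
  rw [sum_range_succ, Nat.sub_self, range_zero, sum_empty, add_zero, map_sum, mul_sum,
    ← sum_range_reflect (fun k => a N * (starRingEnd ℂ) (a k)), ← sum_add_distrib]
  refine sum_congr rfl fun h hh => ?_
  have hh' := mem_range.1 hh
  rw [show N - h = (N - 1 - h) + 1 by omega, sum_range_succ,
    show N - 1 - h + h + 1 = N by omega]

theorem norm_sq_sum_range_eq (a : ℕ → ℂ) (N : ℕ) :
    ‖∑ k ∈ range N, a k‖ ^ 2 = ∑ k ∈ range N, ‖a k‖ ^ 2 +
      2 * (∑ h ∈ range N, ∑ k ∈ range (N - 1 - h), a (k + h + 1) * (starRingEnd ℂ) (a k)).re := by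
  induction N with
  | zero => simp
  | succ N ih =>
    rw [sum_range_succ, sum_range_succ, Nat.add_sub_cancel, sum_mul_conj_succ, add_re]
    simp only [← Complex.normSq_eq_norm_sq] at ih ⊢
    rw [Complex.normSq_add, ih, ← Complex.conj_re (a N * _), map_mul, Complex.conj_conj,
      mul_comm ((starRingEnd ℂ) (a N))]
    ring

theorem norm_sq_sum_range_le (a : ℕ → ℂ) (ha : ∀ k, ‖a k‖ = 1) (N : ℕ) :
    ‖∑ k ∈ range N, a k‖ ^ 2 ≤ N + 2 * ∑ h ∈ range N,
      ‖∑ k ∈ range (N - 1 - h), a (k + h + 1) * (starRingEnd ℂ) (a k)‖ := by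
  rw [norm_sq_sum_range_eq]
  gcongr
  · simp [ha]
  · exact (re_le_norm _).trans (norm_sum_le _ _)

theorem norm_geom_sum_le_card {z : ℂ} (hz : ‖z‖ = 1) (M : ℕ) :
    ‖∑ k ∈ range M, z ^ k‖ ≤ M := by
  refine (norm_sum_le _ _).trans ?_
  simp [hz]

theorem norm_geom_sum_le_two_div {z : ℂ} (hz : ‖z‖ = 1) (hz1 : z ≠ 1) (M : ℕ) :
    ‖∑ k ∈ range M, z ^ k‖ ≤ 2 / ‖z - 1‖ := by
  rw [geom_sum_eq hz1, norm_div]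
  gcongr
  refine (norm_sub_le _ _).trans ?_
  simp [hz]
  norm_num

/-- For `0 < θ < 1`, the partial geometric sums of `exp (2πiθ)`. -/
theorem norm_geom_sum_exp_le {θ : ℝ} (h0 : 0 < θ) (h1 : θ < 1) (M : ℕ) :
    ‖∑ k ∈ range M, Complex.exp (2 * Real.pi * θ * I) ^ k‖ ≤ 1 / 2 * (1 / θ + 1 / (1 - θ)) := by
  have hnorm : ‖Complex.exp (2 * Real.pi * θ * I) - 1‖ = 2 * Real.sin (Real.pi * θ) := by
    have h := Complex.norm_exp_I_mul_ofReal_sub_one (2 * Real.pi * θ)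
    have hs : 0 < Real.sin (Real.pi * θ) :=
      Real.sin_pos_of_pos_of_lt_pi (by positivity) (by nlinarith [Real.pi_pos])
    rw [show 2 * (Real.pi : ℂ) * θ * I = I * ((2 * Real.pi * θ : ℝ) : ℂ) by push_cast; ring, h,
      show 2 * Real.pi * θ / 2 = Real.pi * θ by ring, Real.norm_of_nonneg (by positivity)]
  have hsin : 2 * min θ (1 - θ) ≤ Real.sin (Real.pi * θ) := by
    rcases le_total θ (1 / 2) with h | h
    · rw [min_eq_left (by linarith)]
      have := Real.mul_le_sin (x := Real.pi * θ) (by positivity) (by nlinarith [Real.pi_pos])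
      calc 2 * θ = 2 / Real.pi * (Real.pi * θ) := by field_simp
        _ ≤ _ := this
    · rw [min_eq_right (by linarith)]
      have := Real.mul_le_sin (x := Real.pi * (1 - θ)) (by nlinarith [Real.pi_pos])
        (by nlinarith [Real.pi_pos])
      calc 2 * (1 - θ) = 2 / Real.pi * (Real.pi * (1 - θ)) := by field_simp
        _ ≤ _ := this
        _ = _ := by rw [mul_one_sub, Real.sin_pi_sub]
  have hmin : 0 < min θ (1 - θ) := lt_min h0 (by linarith)
  have hz1 : Complex.exp (2 * Real.pi * θ * I) ≠ 1 := fun h => by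
    rw [h, sub_self, norm_zero] at hnorm
    linarith
  have hz : ‖Complex.exp (2 * Real.pi * θ * I)‖ = 1 := by
    exact_mod_cast Complex.norm_exp_ofReal_mul_I (2 * Real.pi * θ)
  refine (norm_geom_sum_le_two_div hz hz1 M).trans ?_
  rw [hnorm]
  calc 2 / (2 * Real.sin (Real.pi * θ)) ≤ 2 / (2 * (2 * min θ (1 - θ))) := by gcongr
    _ = 1 / 2 * (1 / min θ (1 - θ)) := by field_simp
    _ ≤ _ := by
      gcongr
      have : 0 < 1 - θ := by linarith
      rcases min_choice θ (1 - θ) with h | h <;> rw [h]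
      · have : 0 < 1 / (1 - θ) := by positivity
        linarith
      · have : 0 < 1 / θ := by positivity
        linarith

theorem sum_range_natCast_inv_le (n : ℕ) : ∑ i ∈ range n, ((i : ℕ) : ℝ)⁻¹ ≤ 1 + Real.log n := by
  rcases n with _ | m
  · simp
  · have h := harmonic_le_one_add_log m
    rw [harmonic] at h
    push_cast at h
    rw [sum_range_succ']
    have hlog : Real.log m ≤ Real.log ((m + 1 : ℕ) : ℝ) := by
      rcases Nat.eq_zero_or_pos m with rfl | hm
      · simp
      · exact Real.log_le_log (by exact_mod_cast hm) (by push_cast; linarith)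
    push_cast at hlog ⊢
    simpa using h.trans (by linarith)

/-- Majorant of the geometric sums attached to a residue `r` modulo `q`. -/
noncomputable def residueBound (N : ℝ) (q r : ℕ) : ℝ :=
  ((if r = 0 then N else 0) + (if r = 1 then N else 0) + (if r = q - 1 then N else 0)) +
    q / 2 * (((r - 1 : ℕ) : ℝ)⁻¹ + ((q - 1 - r : ℕ) : ℝ)⁻¹)

theorem residueBound_nonneg {N : ℝ} (hN : 0 ≤ N) (q r : ℕ) : 0 ≤ residueBound N q r := by
  unfold residueBound
  have h : ∀ p : Prop, [Decidable p] → 0 ≤ if p then N else 0 := fun p _ => by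
    split_ifs <;> simp [hN]
  have := h (r = 0)
  have := h (r = 1)
  have := h (r = q - 1)
  positivity

theorem sum_residueBound_le {N : ℝ} (hN : 0 ≤ N) {q : ℕ} (hq : 0 < q) :
    ∑ r ∈ range q, residueBound N q r ≤ 3 * N + q * (1 + Real.log q) := by
  have hind : ∀ s : ℕ, ∑ r ∈ range q, (if r = s then N else 0) ≤ N := fun s => by
    rw [sum_ite_eq']
    split_ifs <;> simp [hN]
  have hH := sum_range_natCast_inv_le q
  have hleft : ∑ r ∈ range q, ((r - 1 : ℕ) : ℝ)⁻¹ ≤ 1 + Real.log q := by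
    refine le_trans ?_ hH
    obtain ⟨m, rfl⟩ : ∃ m, q = m + 1 := ⟨q - 1, by omega⟩
    rw [sum_range_succ', sum_range_succ]
    simp
  have hright : ∑ r ∈ range q, ((q - 1 - r : ℕ) : ℝ)⁻¹ ≤ 1 + Real.log q := by
    rwa [sum_range_reflect (fun i : ℕ => (i : ℝ)⁻¹)]
  unfold residueBound
  rw [sum_add_distrib, sum_add_distrib, sum_add_distrib, ← mul_sum, sum_add_distrib]
  have := hind 0
  have := hind 1
  have := hind (q - 1)
  have : (q : ℝ) / 2 * (∑ r ∈ range q, ((r - 1 : ℕ) : ℝ)⁻¹ + ∑ r ∈ range q, ((q - 1 - r : ℕ) : ℝ)⁻¹)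
      ≤ q / 2 * ((1 + Real.log q) + (1 + Real.log q)) := by gcongr
  linarith

theorem norm_geom_sum_exp_le_residueBound {y : ℝ} {q r M N : ℕ} {m : ℤ} (hr : r < q) (hM : M ≤ N)
    (hy : |y - (m + r / q)| ≤ 1 / q) :
    ‖∑ k ∈ range M, Complex.exp (2 * Real.pi * y * I) ^ k‖ ≤ residueBound N q r := by
  have hq : (0 : ℝ) < q := by exact_mod_cast (Nat.zero_le r).trans_lt hr
  have hz : ‖Complex.exp (2 * Real.pi * y * I)‖ = 1 := by
    exact_mod_cast Complex.norm_exp_ofReal_mul_I (2 * Real.pi * y)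
  have htriv : ‖∑ k ∈ range M, Complex.exp (2 * Real.pi * y * I) ^ k‖ ≤ N :=
    (norm_geom_sum_le_card hz M).trans (by exact_mod_cast hM)
  have hite : ∀ p : Prop, [Decidable p] → (0 : ℝ) ≤ if p then (N : ℝ) else 0 := fun p _ => by
    split_ifs <;> simp
  have h0 := hite (r = 0)
  have h1 := hite (r = 1)
  have h2 := hite (r = q - 1)
  have hpos : (0 : ℝ) ≤ q / 2 * (((r - 1 : ℕ) : ℝ)⁻¹ + ((q - 1 - r : ℕ) : ℝ)⁻¹) := by positivity
  by_cases hedge : r = 0 ∨ r = 1 ∨ r = q - 1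
  · refine htriv.trans ?_
    unfold residueBound
    rcases hedge with h | h | h
    · rw [if_pos h] at h0 ⊢; linarith
    · rw [if_pos h] at h1 ⊢; linarith
    · rw [if_pos h] at h2 ⊢; linarith
  · push Not at hedge
    obtain ⟨hr0, hr1, hrq⟩ := hedge
    have hA : (0 : ℝ) < ((r - 1 : ℕ) : ℝ) := by exact_mod_cast (by omega : 0 < r - 1)
    have hB : (0 : ℝ) < ((q - 1 - r : ℕ) : ℝ) := by exact_mod_cast (by omega : 0 < q - 1 - r)
    have hAc : ((r - 1 : ℕ) : ℝ) = r - 1 := by rw [Nat.cast_sub (by omega)]; simp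
    have hBc : ((q - 1 - r : ℕ) : ℝ) = q - 1 - r := by
      rw [Nat.cast_sub (by omega), Nat.cast_sub (by omega)]; simp
    obtain ⟨hlo, hhi⟩ := abs_le.1 hy
    have hθ : ((r - 1 : ℕ) : ℝ) / q ≤ y - m := by
      rw [hAc, sub_div]; linarith
    have hθ' : ((q - 1 - r : ℕ) : ℝ) / q ≤ 1 - (y - m) := by
      rw [hBc, sub_div, sub_div, div_self hq.ne']; linarith
    have hApos : 0 < ((r - 1 : ℕ) : ℝ) / q := by positivity
    have hBpos : 0 < ((q - 1 - r : ℕ) : ℝ) / q := by positivity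
    have hexp : Complex.exp (2 * Real.pi * y * I) =
        Complex.exp (2 * Real.pi * ((y - m : ℝ) : ℂ) * I) :=
      Complex.exp_eq_exp_iff_exists_int.2 ⟨m, by push_cast; ring⟩
    rw [hexp]
    refine (norm_geom_sum_exp_le (hApos.trans_le hθ) (by linarith) M).trans ?_
    calc 1 / 2 * (1 / (y - m) + 1 / (1 - (y - m)))
        ≤ 1 / 2 * (1 / (((r - 1 : ℕ) : ℝ) / q) + 1 / (((q - 1 - r : ℕ) : ℝ) / q)) := by gcongr
      _ = q / 2 * (((r - 1 : ℕ) : ℝ)⁻¹ + ((q - 1 - r : ℕ) : ℝ)⁻¹) := by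
        rw [one_div_div, one_div_div]; ring
      _ ≤ _ := by unfold residueBound; linarith

theorem sum_range_val_mul {q : ℕ} (hq : 0 < q) {P : ℤ} (hP : IsCoprime P q) (G : ℕ → ℝ) (n : ℕ) :
    ∑ i ∈ range (n * q), G ((P * i : ℤ) : ZMod q).val = n * ∑ r ∈ range q, G r := by
  have : NeZero q := ⟨hq.ne'⟩
  have hrange : ∀ F : ZMod q → ℝ, ∑ i ∈ range q, F (i : ZMod q) = ∑ z : ZMod q, F z := fun F => by
    refine sum_bij (fun i _ => (i : ZMod q)) (fun _ _ => mem_univ _) (fun i hi j hj h => ?_)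
      (fun z _ => ⟨z.val, mem_range.2 z.val_lt, by simp⟩) (fun _ _ => rfl)
    have := congrArg ZMod.val h
    rwa [ZMod.val_cast_of_lt (mem_range.1 hi), ZMod.val_cast_of_lt (mem_range.1 hj)] at this
  have hunit : IsUnit (P : ZMod q) := by
    obtain ⟨a, b, hab⟩ := hP
    refine IsUnit.of_mul_eq_one (a : ZMod q) ?_
    have := congrArg (Int.cast : ℤ → ZMod q) hab
    push_cast at this
    rw [ZMod.natCast_self, mul_zero, add_zero] at this
    rw [mul_comm]; exact this
  obtain ⟨u, hu⟩ := hunit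
  have hone : ∑ i ∈ range q, G ((P * i : ℤ) : ZMod q).val = ∑ r ∈ range q, G r := by
    calc ∑ i ∈ range q, G ((P * i : ℤ) : ZMod q).val
        = ∑ i ∈ range q, (fun z : ZMod q => G ((P : ZMod q) * z).val) (i : ZMod q) := by simp
      _ = ∑ z : ZMod q, G ((u : ZMod q) * z).val := by rw [hrange fun z => G ((P : ZMod q) * z).val, hu]
      _ = ∑ z : ZMod q, G z.val := Equiv.sum_comp (Units.mulLeft u) fun z : ZMod q => G z.val
      _ = ∑ i ∈ range q, G (i : ZMod q).val := (hrange fun z => G z.val).symm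
      _ = ∑ r ∈ range q, G r :=
        sum_congr rfl fun i hi => by rw [ZMod.val_cast_of_lt (mem_range.1 hi)]
  induction n with
  | zero => simp
  | succ n ih =>
    rw [Nat.succ_mul, sum_range_add, ih]
    have : ∑ i ∈ range q, G ((P * ((n * q + i : ℕ) : ℤ) : ℤ) : ZMod q).val =
        ∑ i ∈ range q, G ((P * i : ℤ) : ZMod q).val := by simp
    rw [this, hone]
    push_cast
    ring

/-- The unimodular coefficient `exp (iπk²x + 2πikt)`. -/
noncomputable def quadPhase (x t : ℝ) (k : ℕ) : ℂ :=
  Complex.exp (Real.pi * Complex.I * (k : ℂ) ^ 2 * (x : ℂ) +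
    2 * Real.pi * Complex.I * (k : ℂ) * (t : ℂ))

theorem norm_quadPhase (x t : ℝ) (k : ℕ) : ‖quadPhase x t k‖ = 1 := by
  rw [quadPhase, ← Complex.norm_exp_ofReal_mul_I (Real.pi * k ^ 2 * x + 2 * Real.pi * k * t)]
  congr 2
  push_cast
  ring

theorem norm_sum_quadPhase_mul_conj (x t : ℝ) (h M : ℕ) :
    ‖∑ k ∈ range M, quadPhase x t (k + h + 1 + 1) * (starRingEnd ℂ) (quadPhase x t (k + 1))‖ =
      ‖∑ k ∈ range M, Complex.exp (2 * Real.pi * (((h + 1 : ℕ) * x : ℝ) : ℂ) * I) ^ k‖ := by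
  set c : ℝ := Real.pi * (h + 1) * (h + 3) * x + 2 * Real.pi * (h + 1) * t with hc
  have hterm : ∀ k : ℕ,
      quadPhase x t (k + h + 1 + 1) * (starRingEnd ℂ) (quadPhase x t (k + 1)) =
        Complex.exp (c * I) * Complex.exp (2 * Real.pi * (((h + 1 : ℕ) * x : ℝ) : ℂ) * I) ^ k := by
    intro k
    rw [quadPhase, quadPhase, ← Complex.exp_conj, ← Complex.exp_nat_mul, ← Complex.exp_add,
      ← Complex.exp_add]
    congr 1
    simp only [map_add, map_mul, map_pow, Complex.conj_ofReal, Complex.conj_I, map_natCast,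
      map_ofNat, hc]
    push_cast
    ring
  rw [sum_congr rfl fun k _ => hterm k, ← mul_sum, norm_mul, Complex.norm_exp_ofReal_mul_I, one_mul]

theorem norm_sq_sum_quadPhase_le (x t : ℝ) {P : ℤ} {q q' N : ℕ} (hq : 0 < q)
    (hP : IsCoprime P q) (hx : |x - P / q| ≤ 1 / (q * q')) (hqN : q ≤ N) (hN : N ≤ q') :
    ‖∑ k ∈ range N, quadPhase x t (k + 1)‖ ^ 2 ≤ 16 * (N ^ 2 / q + N * (1 + Real.log q)) := by
  have : NeZero q := ⟨hq.ne'⟩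
  have hqR : (0 : ℝ) < q := by exact_mod_cast hq
  have hqNR : (q : ℝ) ≤ N := by exact_mod_cast hqN
  have hNR : (0 : ℝ) < N := hqR.trans_le hqNR
  have hq'R : (0 : ℝ) < q' := hNR.trans_le (by exact_mod_cast hN)
  have hlog : 0 ≤ Real.log q := Real.log_natCast_nonneg q
  have hterm : ∀ h ∈ range N, ‖∑ k ∈ range (N - 1 - h),
      quadPhase x t (k + h + 1 + 1) * (starRingEnd ℂ) (quadPhase x t (k + 1))‖ ≤
        residueBound N q ((P * (h + 1 : ℕ) : ℤ) : ZMod q).val := by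
    intro h hh
    have hh' : h + 1 ≤ N := mem_range.1 hh
    rw [norm_sum_quadPhase_mul_conj]
    refine norm_geom_sum_exp_le_residueBound (m := P * (h + 1 : ℕ) / q) (ZMod.val_lt _)
      (by omega) ?_
    have hval : ((((P * (h + 1 : ℕ) : ℤ) : ZMod q).val : ℕ) : ℤ) = P * (h + 1 : ℕ) % q :=
      ZMod.val_intCast _
    have hdiv := Int.mul_ediv_add_emod (P * (h + 1 : ℕ)) q
    rw [← hval] at hdiv
    have hsplit : ∀ e : ℤ, ∀ r : ℕ, q * e + r = P * (h + 1 : ℕ) →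
        (e : ℝ) + r / q = (h + 1 : ℕ) * (P / q) := fun e r her => by
      have herR : (q : ℝ) * e + r = P * (h + 1 : ℕ) := by exact_mod_cast her
      field_simp
      linear_combination herR
    rw [hsplit _ _ hdiv, ← mul_sub, abs_mul, Nat.abs_cast]
    calc ((h + 1 : ℕ) : ℝ) * |x - P / q| ≤ q' * (1 / (q * q')) := by
          gcongr
          exact hh'.trans hN
      _ = 1 / q := by field_simp
  have hnonneg : ∀ r, 0 ≤ residueBound N q r := residueBound_nonneg hNR.le q
  have hsum : ∑ h ∈ range N, residueBound N q ((P * (h + 1 : ℕ) : ℤ) : ZMod q).val ≤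
      ((N / q + 1 : ℕ) : ℝ) * ∑ r ∈ range q, residueBound N q r := by
    rw [← sum_range_val_mul hq hP]
    have hlt : N < (N / q + 1) * q := by
      rw [mul_comm]; exact Nat.lt_mul_div_succ N hq
    calc _ ≤ ∑ i ∈ range (N + 1), residueBound N q ((P * (i : ℕ) : ℤ) : ZMod q).val := by
          rw [sum_range_succ']
          exact le_add_of_nonneg_right (hnonneg _)
      _ ≤ _ := sum_le_sum_of_subset_of_nonneg (range_subset_range.2 hlt) fun _ _ _ => hnonneg _
  have hblocks : ((N / q + 1 : ℕ) : ℝ) ≤ 2 * (N / q) := by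
    have h1 : ((N / q : ℕ) : ℝ) ≤ N / q := Nat.cast_div_le
    have h2 : (1 : ℝ) ≤ N / q := (one_le_div hqR).2 hqNR
    push_cast
    linarith
  have hfinal : ∑ h ∈ range N, ‖∑ k ∈ range (N - 1 - h),
      quadPhase x t (k + h + 1 + 1) * (starRingEnd ℂ) (quadPhase x t (k + 1))‖ ≤
        2 * (N / q) * (3 * N + q * (1 + Real.log q)) := by
    refine (sum_le_sum hterm).trans (hsum.trans ?_)
    exact mul_le_mul hblocks (sum_residueBound_le hNR.le hq) (sum_nonneg fun r _ => hnonneg r)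
      (by positivity)
  refine (norm_sq_sum_range_le _ (fun k => norm_quadPhase x t (k + 1)) N).trans ?_
  have hexpand : 2 * ((N : ℝ) / q) * (3 * N + q * (1 + Real.log q)) =
      6 * (N ^ 2 / q) + 2 * (N * (1 + Real.log q)) := by
    field_simp
    ring
  have h3 : 0 ≤ (N : ℝ) ^ 2 / q := by positivity
  have h4 : (N : ℝ) ≤ N * (1 + Real.log q) := by nlinarith
  linarith

theorem norm_sum_quadPhase_le (x t : ℝ) {P : ℤ} {q q' N : ℕ} (hq : 0 < q)
    (hP : IsCoprime P q) (hx : |x - P / q| ≤ 1 / (q * q')) (hqN : q ≤ N) (hN : N ≤ q') :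
    ‖∑ k ∈ range N, quadPhase x t (k + 1)‖ ≤ 4 * (N / √q + √N * (1 + Real.log q)) := by
  have hlog : 0 ≤ Real.log q := Real.log_natCast_nonneg q
  have hqR : (0 : ℝ) < q := by exact_mod_cast hq
  refine (sq_le_sq₀ (norm_nonneg _) (by positivity)).1 ?_
  refine (norm_sq_sum_quadPhase_le x t hq hP hx hqN hN).trans ?_
  have hA : ((N : ℝ) / √q) ^ 2 = N ^ 2 / q := by rw [div_pow, Real.sq_sqrt hqR.le]
  have hB : (√(N : ℝ) * (1 + Real.log q)) ^ 2 = N * (1 + Real.log q) ^ 2 := by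
    rw [mul_pow, Real.sq_sqrt (Nat.cast_nonneg N)]
  have hC : 0 ≤ (N : ℝ) / √q * (√(N : ℝ) * (1 + Real.log q)) := by positivity
  have hD : (N : ℝ) * (1 + Real.log q) ≤ N * (1 + Real.log q) ^ 2 := by
    gcongr
    nlinarith
  rw [mul_pow, add_sq, hA, hB]
  linarith

theorem sum_range_div_succ_eq (a : ℕ → ℂ) (n : ℕ) :
    ∑ k ∈ range n, a k / ((k + 1 : ℕ) : ℂ) = (∑ k ∈ range n, a k) / ((n + 1 : ℕ) : ℂ) +
      ∑ m ∈ range (n + 1), (∑ k ∈ range m, a k) / ((m : ℂ) * ((m + 1 : ℕ) : ℂ)) := by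
  induction n with
  | zero => simp
  | succ n ih =>
    rw [sum_range_succ, ih, sum_range_succ _ (n + 1), sum_range_succ a]
    have h1 : ((n + 1 : ℕ) : ℂ) ≠ 0 := Nat.cast_ne_zero.2 (by omega)
    have h2 : ((n + 1 + 1 : ℕ) : ℂ) ≠ 0 := Nat.cast_ne_zero.2 (by omega)
    field_simp
    push_cast
    ring

theorem exists_le_lt_succ_of_tendsto {q : ℕ → ℕ} (hq : Tendsto q atTop atTop) {J m : ℕ}
    (hm : q J ≤ m) (hmono : Monotone q) : ∃ j, J ≤ j ∧ q j ≤ m ∧ m < q (j + 1) := by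
  classical
  have hex : ∃ i, m < q i := (hq.eventually (eventually_gt_atTop m)).exists
  have hJ : J < Nat.find hex := by
    by_contra! h
    exact absurd (Nat.find_spec hex) (by have := hmono h; omega)
  refine ⟨Nat.find hex - 1, by omega, not_lt.1 (Nat.find_min hex (by omega)), ?_⟩
  rw [Nat.sub_add_cancel (by omega)]
  exact Nat.find_spec hex

theorem one_div_succ_le_log_sub {m : ℕ} (hm : 0 < m) :
    1 / ((m : ℝ) + 1) ≤ Real.log ((m + 1 : ℕ) : ℝ) - Real.log m := by
  have hmR : (0 : ℝ) < m := by exact_mod_cast hm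
  have h := Real.one_sub_inv_le_log_of_pos (x := ((m : ℝ) + 1) / m) (by positivity)
  rw [Real.log_div (by positivity) hmR.ne', inv_div] at h
  push_cast
  refine le_trans (le_of_eq ?_) h
  field_simp
  ring

theorem one_div_sqrt_mul_succ_le {m : ℕ} (hm : 0 < m) :
    1 / (√(m : ℝ) * (m + 1)) ≤ 2 * (1 / √(m : ℝ) - 1 / √((m + 1 : ℕ) : ℝ)) := by
  have hmR : (0 : ℝ) < m := by exact_mod_cast hm
  push_cast
  set u := √(m : ℝ) with hu
  set v := √((m : ℝ) + 1) with hv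
  have hu0 : 0 < u := Real.sqrt_pos.2 hmR
  have hv0 : 0 < v := Real.sqrt_pos.2 (by linarith)
  have hu2 : u ^ 2 = m := Real.sq_sqrt hmR.le
  have hv2 : v ^ 2 = m + 1 := Real.sq_sqrt (by linarith)
  have huv : u ≤ v := Real.sqrt_le_sqrt (by linarith)
  rw [← hv2, div_sub_div _ _ hu0.ne' hv0.ne', ← mul_div_assoc, div_le_div_iff₀ (by positivity)
    (by positivity)]
  have h1 : (v - u) * (v + u) = 1 := by linear_combination hv2 - hu2
  have h2 : 1 ≤ 2 * v * (v - u) := by nlinarith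
  nlinarith [mul_pos hu0 hv0]

theorem exists_tendsto_sum_div_of_norm_sum_le {a : ℕ → ℂ} {q : ℕ → ℕ} (hq0 : q 0 = 1)
    (hmono : Monotone q) (hq : Tendsto q atTop atTop)
    (hsum : Summable fun j => Real.log (q (j + 1)) / √(q j : ℝ))
    (hS : ∀ j m, q j ≤ m → m ≤ q (j + 1) →
      ‖∑ k ∈ range m, a k‖ ≤ 4 * (m / √(q j : ℝ) + √(m : ℝ) * (1 + Real.log (q j)))) :
    ∃ L : ℂ, Tendsto (fun n => ∑ k ∈ range n, a k / ((k + 1 : ℕ) : ℂ)) atTop (𝓝 L) := by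
  have hqpos : ∀ j, 0 < q j := fun j => by
    have := hmono (Nat.zero_le j)
    omega
  have hqR : ∀ j, (0 : ℝ) < q j := fun j => by exact_mod_cast hqpos j
  have hlog0 : ∀ j, 0 ≤ Real.log (q j) := fun j => Real.log_natCast_nonneg _
  have hlogmono : ∀ j, Real.log (q j) ≤ Real.log (q (j + 1)) := fun j =>
    Real.log_le_log (hqR j) (by exact_mod_cast hmono j.le_succ)
  set A : ℕ → ℝ := fun j => (1 + Real.log (q (j + 1))) / √(q j : ℝ) with hA
  have hA0 : ∀ j, 0 ≤ A j := fun j => div_nonneg (by linarith [hlog0 (j + 1)]) (Real.sqrt_nonneg _)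
  have hAsum : Summable A := by
    have hlarge : ∀ᶠ j in atTop, (1 : ℝ) ≤ Real.log (q (j + 1)) :=
      (Real.tendsto_log_atTop.comp (tendsto_natCast_atTop_atTop.comp
        (hq.comp (tendsto_add_atTop_nat 1)))).eventually (eventually_ge_atTop 1)
    refine summable_of_isBigO_nat hsum (Asymptotics.IsBigO.of_bound 2 ?_)
    filter_upwards [hlarge] with j hj
    rw [Real.norm_of_nonneg (hA0 j), Real.norm_of_nonneg
      (div_nonneg (hlog0 _) (Real.sqrt_nonneg _)), ← mul_div_assoc]
    simp only [hA]
    gcongr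
    linarith
  set w : ℕ → ℝ := fun m => ‖∑ k ∈ range m, a k‖ / ((m : ℝ) * (m + 1)) with hw
  have hw0 : ∀ m, 0 ≤ w m := fun m => by positivity
  have hpoint : ∀ j m, q j ≤ m → m < q (j + 1) →
      w m ≤ 4 / √(q j : ℝ) * (Real.log ((m + 1 : ℕ) : ℝ) - Real.log m) +
        8 * (1 + Real.log (q j)) * (1 / √(m : ℝ) - 1 / √((m + 1 : ℕ) : ℝ)) := by
    intro j m h1 h2
    have hm : 0 < m := (hqpos j).trans_le h1
    have hmR : (0 : ℝ) < m := by exact_mod_cast hm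
    have hsq := Real.sqrt_pos.2 (hqR j)
    have hsm := Real.sqrt_pos.2 hmR
    have hL := hlog0 j
    calc w m ≤ 4 * (m / √(q j : ℝ) + √(m : ℝ) * (1 + Real.log (q j))) / (m * (m + 1)) := by
          simp only [hw]
          gcongr
          exact hS j m h1 h2.le
      _ = 4 / √(q j : ℝ) * (1 / (m + 1)) +
          4 * (1 + Real.log (q j)) * (1 / (√(m : ℝ) * (m + 1))) := by
        nth_rw 2 [← Real.mul_self_sqrt hmR.le]
        field_simp
        rw [Real.sq_sqrt hmR.le]
        linear_combination (√(q j : ℝ) + √(q j : ℝ) * Real.log (q j)) * Real.sq_sqrt hmR.le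
      _ ≤ 4 / √(q j : ℝ) * (Real.log ((m + 1 : ℕ) : ℝ) - Real.log m) +
          4 * (1 + Real.log (q j)) * (2 * (1 / √(m : ℝ) - 1 / √((m + 1 : ℕ) : ℝ))) := by
        gcongr
        · exact one_div_succ_le_log_sub hm
        · exact one_div_sqrt_mul_succ_le hm
      _ = _ := by ring
  have hblock : ∀ j, ∑ m ∈ Ico (q j) (q (j + 1)), w m ≤ 12 * A j := by
    intro j
    have hle : q j ≤ q (j + 1) := hmono j.le_succ
    have hneg : ∀ m : ℕ, 1 / √(m : ℝ) - 1 / √((m + 1 : ℕ) : ℝ) =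
        (fun i : ℕ => -(1 / √(i : ℝ))) (m + 1) - (fun i : ℕ => -(1 / √(i : ℝ))) m := fun m => by
      ring
    have hsq := Real.sqrt_pos.2 (hqR j)
    refine (sum_le_sum fun m hm => hpoint j m (mem_Ico.1 hm).1 (mem_Ico.1 hm).2).trans ?_
    rw [sum_add_distrib, ← mul_sum, ← mul_sum, sum_congr rfl fun m _ => hneg m,
      sum_Ico_sub (fun i : ℕ => Real.log (i : ℝ)) hle,
      sum_Ico_sub (fun i : ℕ => -(1 / √(i : ℝ))) hle]
    have h1 : 4 / √(q j : ℝ) * (Real.log (q (j + 1)) - Real.log (q j)) ≤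
        4 / √(q j : ℝ) * (1 + Real.log (q (j + 1))) := by
      gcongr
      linarith [hlog0 j]
    have h2 : 8 * (1 + Real.log (q j)) * (-(1 / √(q (j + 1) : ℝ)) - -(1 / √(q j : ℝ))) ≤
        8 * (1 + Real.log (q (j + 1))) * (1 / √(q j : ℝ)) := by
      have h3 : 0 ≤ 1 / √(q (j + 1) : ℝ) := by positivity
      have h4 : 0 ≤ 1 + Real.log (q j) := by linarith [hlog0 j]
      have h5 := hlogmono j
      calc _ ≤ 8 * (1 + Real.log (q j)) * (1 / √(q j : ℝ)) := by gcongr; linarith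
        _ ≤ _ := by gcongr
    refine (add_le_add h1 h2).trans (le_of_eq ?_)
    simp only [hA]
    ring
  have hpartial : ∀ J, ∑ m ∈ range (q J), w m ≤ 12 * ∑ j ∈ range J, A j := by
    intro J
    induction J with
    | zero => simp [hq0, hw]
    | succ J ih =>
      rw [range_eq_Ico, ← sum_Ico_consecutive w (Nat.zero_le _) (hmono J.le_succ), ← range_eq_Ico,
        sum_range_succ, mul_add]
      exact add_le_add ih (hblock J)
  have hwsum : Summable w := by
    refine summable_of_sum_range_le (c := 12 * ∑' j, A j) hw0 fun n => ?_
    obtain ⟨J, hJ⟩ := (hq.eventually (eventually_ge_atTop n)).exists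
    calc ∑ m ∈ range n, w m ≤ ∑ m ∈ range (q J), w m :=
          sum_le_sum_of_subset_of_nonneg (range_subset_range.2 hJ) fun _ _ _ => hw0 _
      _ ≤ 12 * ∑ j ∈ range J, A j := hpartial J
      _ ≤ _ := by
        gcongr
        exact hAsum.sum_le_tsum _ fun j _ => hA0 j
  have hsummable : Summable fun m : ℕ =>
      (∑ k ∈ range m, a k) / ((m : ℂ) * ((m + 1 : ℕ) : ℂ)) := by
    refine Summable.of_norm (hwsum.congr fun m => ?_)
    simp only [hw]
    rw [norm_div, norm_mul, Complex.norm_natCast, Complex.norm_natCast]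
    push_cast
    rfl
  have hmean : Tendsto (fun n => (∑ k ∈ range n, a k) / ((n + 1 : ℕ) : ℂ)) atTop (𝓝 0) := by
    rw [Metric.tendsto_atTop]
    intro ε hε
    obtain ⟨J, hJ⟩ := (Metric.tendsto_atTop.1 hAsum.tendsto_atTop_zero) (ε / 8) (by positivity)
    refine ⟨q J, fun n hn => ?_⟩
    obtain ⟨j, hJj, h1, h2⟩ := exists_le_lt_succ_of_tendsto hq hn hmono
    have hnpos : 0 < n := (hqpos j).trans_le h1
    have hnR : (0 : ℝ) < n := by exact_mod_cast hnpos
    have hsq := Real.sqrt_pos.2 (hqR j)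
    have hAj := hJ j hJj
    rw [Real.dist_0_eq_abs, abs_of_nonneg (hA0 j)] at hAj
    have hL := hlog0 j
    have hL' := hlogmono j
    rw [dist_zero_right, norm_div, Complex.norm_natCast]
    calc ‖∑ k ∈ range n, a k‖ / ((n + 1 : ℕ) : ℝ)
        ≤ 4 * (n / √(q j : ℝ) + √(n : ℝ) * (1 + Real.log (q j))) / n := by
          gcongr
          · exact hS j n h1 h2.le
          · exact n.le_succ
      _ = 4 * (1 / √(q j : ℝ) + (1 + Real.log (q j)) / √(n : ℝ)) := by
        have hsn := Real.sqrt_pos.2 hnR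
        nth_rw 3 [← Real.mul_self_sqrt hnR.le]
        field_simp
        linear_combination -Real.sq_sqrt hnR.le
      _ ≤ 4 * ((1 + Real.log (q (j + 1))) / √(q j : ℝ) +
          (1 + Real.log (q (j + 1))) / √(q j : ℝ)) := by
        gcongr
        linarith
      _ = 8 * A j := by simp only [hA]; ring
      _ < ε := by linarith
  refine ⟨0 + ∑' m : ℕ, (∑ k ∈ range m, a k) / ((m : ℂ) * ((m + 1 : ℕ) : ℂ)), ?_⟩
  simp only [sum_range_div_succ_eq]
  exact hmean.add (hsummable.hasSum.tendsto_sum_nat.comp (tendsto_add_atTop_nat 1))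

theorem Fpart_one_eq (n : ℕ) (x t : ℝ) :
    Fpart 1 n x t = ∑ k ∈ range n, quadPhase x t (k + 1) / ((k + 1 : ℕ) : ℂ) := by
  rw [Fpart, ← Finset.Ico_add_one_right_eq_Icc, sum_Ico_eq_sum_range, Nat.add_sub_cancel]
  refine sum_congr rfl fun k _ => ?_
  rw [Complex.ofReal_one, Complex.cpow_one, add_comm 1 k, quadPhase]

/-- convergence of `F_1(x,t)` under `Σ log(Q_{k+1})/√Q_k < ∞`. -/
theorem stmt1 (x : ℝ) (hx : x ∈ Set.Ioo (0 : ℝ) 1) (hirr : Irrational x) (t : ℝ)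
    (hsum : Summable (fun k : ℕ => Real.log (Qden x (k + 1)) / Real.sqrt (Qden x k))) :
    ∃ L : ℂ, Tendsto (fun n : ℕ => Fpart 1 n x t) atTop (𝓝 L) := by
  obtain ⟨P, q, hden, hq0, hmono, hfib, hcop, happrox⟩ := exists_convergents_of_irrational hirr
  have hq : Tendsto q atTop atTop := by
    refine tendsto_atTop_mono' _ ?_ tendsto_id
    filter_upwards [eventually_ge_atTop 5] with n hn
    exact (Nat.le_fib_self hn).trans ((Nat.fib_mono n.le_succ).trans (hfib n))
  have hpos : ∀ n, 0 < q n := fun n => (Nat.fib_pos.2 n.succ_pos).trans_le (hfib n)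
  simp only [Qden, hden] at hsum
  simp only [Fpart_one_eq]
  exact exists_tendsto_sum_div_of_norm_sum_le hq0 hmono hq hsum fun j m h1 h2 =>
    norm_sum_quadPhase_le x t (hpos j) (hcop j) (happrox j) h1 h2
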